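/- Let Y be a finite-dimensional real normed space, E a normed space, X a convex subset of Y that is either closed and unbounded, or open, K ⊆ X a closed, bounded and convex set, and let g satisfy hypotheses (g0) and (g1) and be such that ψ_t² ∈ C(X;ℝ,g) for every t ∈ Y; set h(t,u) = g(u) − [g(t) + ⟨g'(t), u − t⟩]. For each n ≥ 1 let L_n : D(L_n) → F(K;E) be a linear operator dominated by a positive linear operator S_n : D(S_n) → F(K;ℝ), with C(X;E,g) ⊆ D(L_n) and C(X;ℝ,g) ⊆ D(S_n); set γ_n(t) := (S_n(ψ_t²)(t))^{1/2}. Let K₁ be a closed subset of the interior of K, and suppose that each L_n preserves the constants and that S_n(𝟙)(t) = 1 for all t ∈ K₁ and n ≥ 1. Then for every F ∈ C(X;E,g) there exists a constant M > 0, depending only on F, K, K₁ and g, such that for all n ≥ 1 and all t ∈ K₁ with γ_n(t) > 0: ‖L_n(F)(t) − F(t)‖ ≤ 2·ω(F,γ_n(t)) + M·S_n(h(t,·))(t), where ω(F,·) is the modulus of continuity of F restricted to K. -/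

import Mathlib

open Filter Topology Bornology

/-- Membership in `C(X;E,g)`: continuous on `X` with growth controlled by `g`. -/
def MemCg {Y E : Type*} [NormedAddCommGroup Y] [NormedAddCommGroup E]
    (X : Set Y) (g : Y → ℝ) (F : Y → E) : Prop :=
  ContinuousOn F X ∧ ∃ M > 0, ∀ u ∈ X, ‖F u‖ ≤ M * g u

/-- The modulus of continuity of `F` on `K`:
`ω(F,δ) = sup {‖F u − F t‖ : t, u ∈ K, ‖t − u‖ ≤ δ}`. -/
noncomputable def modulusOfContinuity {Y E : Type*} [NormedAddCommGroup Y]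
    [NormedAddCommGroup E] (K : Set Y) (F : Y → E) (δ : ℝ) : ℝ :=
  sSup {r : ℝ | ∃ t ∈ K, ∃ u ∈ K, ‖t - u‖ ≤ δ ∧ r = ‖F u - F t‖}

/-- The geometric setting of Theorem 4 (finite-dimensional case): `X ⊆ Y` convex and
either closed and unbounded or open, `K ⊆ X` closed, bounded and convex, and `g`
satisfying the hypotheses (g0) and (g1). -/
structure GSettingFin (Y : Type*) [NormedAddCommGroup Y] [NormedSpace ℝ Y] where
  X : Set Y
  K : Set Y
  g : Y → ℝ
  g' : Y → (Y →L[ℝ] ℝ)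
  conv : Convex ℝ X
  closed_unbounded_or_open : (IsClosed X ∧ ¬ IsBounded X) ∨ IsOpen X
  K_sub : K ⊆ X
  K_closed : IsClosed K
  K_bdd : IsBounded K
  K_conv : Convex ℝ K
  -- (g0)
  g_pos : ∀ u ∈ X, 0 < g u
  g_sconv : StrictConvexOn ℝ X g
  g_cont : ContinuousOn g X
  g_diff : ∀ t ∈ K, HasFDerivWithinAt g (g' t) X t
  g'_cont : ContinuousOn g' K
  -- (g1): with B_n := g⁻¹([0,n]) (as a subset of X)
  sublevel_K : ∀ n : ℕ, 1 ≤ n → K ⊆ X ∩ g ⁻¹' Set.Icc (0 : ℝ) (n : ℝ)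
  sublevel_bdd : ∀ n : ℕ, 1 ≤ n → IsBounded (X ∩ g ⁻¹' Set.Icc (0 : ℝ) (n : ℝ))
  sublevel_ne : ∀ n : ℕ, 1 ≤ n → (X \ (X ∩ g ⁻¹' Set.Icc (0 : ℝ) (n : ℝ))).Nonempty
  g_growth : ¬ IsBounded X →
    Tendsto (fun u => g u / ‖u‖) (comap (fun u : Y => ‖u‖) atTop ⊓ 𝓟 X) atTop

variable {Y : Type*} [NormedAddCommGroup Y] [NormedSpace ℝ Y]

/-- `h(t,u) = g(u) − [g(t) + ⟨g'(t), u − t⟩]`. -/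
noncomputable def GSettingFin.h (σ : GSettingFin Y) (t u : Y) : ℝ :=
  σ.g u - (σ.g t + σ.g' t (u - t))

section Modulus

variable {E : Type*} [NormedAddCommGroup E]

lemma norm_sub_le_modulusOfContinuity {Z : Type*} [NormedAddCommGroup Z] {K : Set Z}
    (hK : IsCompact K) {F : Z → E} (hF : ContinuousOn F K) {δ : ℝ} {t u : Z}
    (ht : t ∈ K) (hu : u ∈ K) (h : ‖t - u‖ ≤ δ) :
    ‖F u - F t‖ ≤ modulusOfContinuity K F δ := by
  obtain ⟨C, hC⟩ := hK.exists_bound_of_continuousOn hF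
  refine le_csSup ⟨C + C, ?_⟩ ⟨t, ht, u, hu, h, rfl⟩
  rintro r ⟨t, ht, u, hu, -, rfl⟩
  exact (norm_sub_le _ _).trans (add_le_add (hC u hu) (hC t ht))

lemma norm_sub_le_nat_mul_modulusOfContinuity {K : Set Y} (hK : IsCompact K)
    (hconv : Convex ℝ K) {F : Y → E} (hF : ContinuousOn F K) {δ : ℝ} {t : Y} (ht : t ∈ K)
    (N : ℕ) {u : Y} (hu : u ∈ K) (h : ‖u - t‖ ≤ N * δ) :
    ‖F u - F t‖ ≤ N * modulusOfContinuity K F δ := by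
  induction N generalizing u with
  | zero =>
    have : u = t := by
      rw [← sub_eq_zero, ← norm_le_zero_iff]
      simpa using h
    simp [this]
  | succ N ih =>
    push_cast at h ⊢
    have hN : (0 : ℝ) < N + 1 := by positivity
    set s : ℝ := N / (N + 1) with hs
    have hs0 : 0 ≤ s := by positivity
    have hs1 : s ≤ 1 := by rw [hs, div_le_one hN]; linarith
    have hv : t + s • (u - t) ∈ K := hconv.add_smul_sub_mem ht hu ⟨hs0, hs1⟩
    have h1 : ‖t + s • (u - t) - t‖ ≤ N * δ := by
      rw [add_sub_cancel_left, norm_smul, Real.norm_of_nonneg hs0]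
      calc s * ‖u - t‖ ≤ s * ((N + 1) * δ) := by gcongr
        _ = N * δ := by rw [hs]; field_simp
    have h2 : ‖t + s • (u - t) - u‖ ≤ δ := by
      have : t + s • (u - t) - u = (s - 1) • (u - t) := by module
      rw [this, norm_smul, Real.norm_of_nonpos (by linarith)]
      calc -(s - 1) * ‖u - t‖ ≤ -(s - 1) * ((N + 1) * δ) := by
            gcongr
            linarith
        _ = δ := by rw [hs]; field_simp; ring
    calc ‖F u - F t‖ ≤ ‖F u - F (t + s • (u - t))‖ + ‖F (t + s • (u - t)) - F t‖ :=
          norm_sub_le_norm_sub_add_norm_sub _ _ _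
      _ ≤ modulusOfContinuity K F δ + N * modulusOfContinuity K F δ :=
          add_le_add (norm_sub_le_modulusOfContinuity hK hF hv hu h2) (ih hv h1)
      _ = (N + 1) * modulusOfContinuity K F δ := by ring

lemma modulusOfContinuity_nonneg {Z : Type*} [NormedAddCommGroup Z] (K : Set Z) (F : Z → E)
    (δ : ℝ) :
    0 ≤ modulusOfContinuity K F δ := by
  refine Real.sSup_nonneg ?_
  rintro r ⟨t, -, u, -, -, rfl⟩
  exact norm_nonneg _

lemma norm_sub_le_one_add_sq_mul_modulusOfContinuity {K : Set Y} (hK : IsCompact K)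
    (hconv : Convex ℝ K) {F : Y → E} (hF : ContinuousOn F K) {δ : ℝ} (hδ : 0 < δ) {t u : Y}
    (ht : t ∈ K) (hu : u ∈ K) :
    ‖F u - F t‖ ≤ (1 + ‖u - t‖ ^ 2 / δ ^ 2) * modulusOfContinuity K F δ := by
  have hω := modulusOfContinuity_nonneg K F δ
  rw [← div_pow]
  set x := ‖u - t‖ / δ with hx
  have hx0 : 0 ≤ x := by positivity
  rcases le_or_gt ‖u - t‖ δ with h | h
  · calc ‖F u - F t‖ ≤ modulusOfContinuity K F δ :=
          norm_sub_le_modulusOfContinuity hK hF ht hu (by rwa [norm_sub_rev])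
      _ ≤ (1 + x ^ 2) * modulusOfContinuity K F δ := le_mul_of_one_le_left hω (by nlinarith)
  · have hx1 : 1 < x := by rwa [hx, one_lt_div hδ]
    refine (norm_sub_le_nat_mul_modulusOfContinuity (δ := δ) hK hconv hF ht ⌈x⌉₊ hu ?_).trans ?_
    · exact (div_le_iff₀ hδ).1 (Nat.le_ceil x)
    · have := Nat.ceil_lt_add_one hx0
      gcongr
      nlinarith

end Modulus

section Convexity

/-- The tangent inequality for a convex function. -/
lemma ConvexOn.hasFDerivWithinAt_apply_sub_le {X : Set Y} {g : Y → ℝ} (hg : ConvexOn ℝ X g)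
    {t u : Y} (ht : t ∈ X) (hu : u ∈ X) {g' : Y →L[ℝ] ℝ} (hd : HasFDerivWithinAt g g' X t) :
    g' (u - t) ≤ g u - g t := by
  have hmaps : Set.MapsTo (fun s : ℝ => t + s • (u - t)) (Set.Icc 0 1) X :=
    fun s hs => hg.1.add_smul_sub_mem ht hu hs
  have hline : HasDerivWithinAt (fun s : ℝ => t + s • (u - t)) (u - t) (Set.Icc 0 1) 0 := by
    simpa using (((hasDerivAt_id (0 : ℝ)).smul_const (u - t)).const_add t).hasDerivWithinAt
  have hcomp : HasDerivWithinAt (fun s : ℝ => g (t + s • (u - t))) (g' (u - t))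
      (Set.Icc 0 1) 0 := by
    refine HasFDerivWithinAt.comp_hasDerivWithinAt (t := X) (0 : ℝ) (l := g) ?_ hline hmaps
    simpa using hd
  have hIoc : Set.Icc (0 : ℝ) 1 \ {0} = Set.Ioc 0 1 := by simp
  rw [hasDerivWithinAt_iff_tendsto_slope, hIoc] at hcomp
  have : (𝓝[Set.Ioc (0 : ℝ) 1] 0).NeBot := by
    rw [nhdsWithin_Ioc_eq_nhdsGT zero_lt_one]
    infer_instance
  refine le_of_tendsto hcomp ?_
  filter_upwards [self_mem_nhdsWithin] with s hs
  have hc := hg.2 ht hu (sub_nonneg.2 hs.2) hs.1.le (sub_add_cancel 1 s)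
  have he : (1 - s) • t + s • u = t + s • (u - t) := by module
  rw [he] at hc
  simp only [slope_def_field, zero_smul, add_zero, sub_zero, smul_eq_mul] at hc ⊢
  rw [div_le_iff₀ hs.1]
  linarith

lemma StrictConvexOn.hasFDerivWithinAt_apply_sub_lt {X : Set Y} {g : Y → ℝ}
    (hg : StrictConvexOn ℝ X g) {t u : Y} (ht : t ∈ X) (hu : u ∈ X) (hne : t ≠ u)
    {g' : Y →L[ℝ] ℝ} (hd : HasFDerivWithinAt g g' X t) :
    g' (u - t) < g u - g t := by
  have hw : t + (1 / 2 : ℝ) • (u - t) ∈ X := hg.1.add_smul_sub_mem ht hu (by norm_num)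
  have h1 := hg.convexOn.hasFDerivWithinAt_apply_sub_le ht hw hd
  have h2 := hg.2 ht hu hne (half_pos one_pos) (half_pos one_pos) (add_halves (1 : ℝ))
  have he : (1 / 2 : ℝ) • t + (1 / 2 : ℝ) • u = t + (1 / 2 : ℝ) • (u - t) := by module
  rw [he] at h2
  rw [add_sub_cancel_left, map_smul] at h1
  simp only [smul_eq_mul] at h1 h2
  linarith

end Convexity

namespace GSettingFin

variable (σ : GSettingFin Y)

lemma h_nonneg {t u : Y} (ht : t ∈ σ.K) (hu : u ∈ σ.X) : 0 ≤ σ.h t u := by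
  have := σ.g_sconv.convexOn.hasFDerivWithinAt_apply_sub_le (σ.K_sub ht) hu (σ.g_diff t ht)
  unfold h
  linarith

lemma h_pos {t u : Y} (ht : t ∈ σ.K) (hu : u ∈ σ.X) (hne : t ≠ u) : 0 < σ.h t u := by
  have := σ.g_sconv.hasFDerivWithinAt_apply_sub_lt (σ.K_sub ht) hu hne (σ.g_diff t ht)
  unfold h
  linarith

lemma h_add_smul_le {t u : Y} (ht : t ∈ σ.X) (hu : u ∈ σ.X) {s : ℝ} (hs0 : 0 ≤ s)
    (hs1 : s ≤ 1) : σ.h t (t + s • (u - t)) ≤ s * σ.h t u := by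
  have hc := σ.g_sconv.convexOn.2 ht hu (sub_nonneg.2 hs1) hs0 (sub_add_cancel 1 s)
  have he : (1 - s) • t + s • u = t + s • (u - t) := by module
  rw [he] at hc
  simp only [smul_eq_mul] at hc
  unfold h
  rw [add_sub_cancel_left, map_smul, smul_eq_mul]
  linarith

lemma continuousOn_h : ContinuousOn (fun p : Y × Y => σ.h p.1 p.2) (σ.K ×ˢ σ.K) := by
  have hg := σ.g_cont.mono σ.K_sub
  have h1 : Set.MapsTo Prod.fst (σ.K ×ˢ σ.K) σ.K := fun p hp => hp.1
  have h2 : Set.MapsTo Prod.snd (σ.K ×ˢ σ.K) σ.K := fun p hp => hp.2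
  refine (hg.comp continuousOn_snd h2).sub ((hg.comp continuousOn_fst h1).add ?_)
  exact (σ.g'_cont.comp continuousOn_fst h1).clm_apply (continuousOn_snd.sub continuousOn_fst)

/-- Away from `K`, the function `h` is bounded below, uniformly in `t ∈ K₁`, by a multiple of
`1 + g`. -/
lemma exists_one_add_g_le_mul_h [FiniteDimensional ℝ Y] {K₁ : Set Y} (hK₁closed : IsClosed K₁)
    (hK₁ : K₁ ⊆ interior σ.K) :
    ∃ C > 0, ∀ t ∈ K₁, ∀ u ∈ σ.X, u ∉ σ.K → 1 + σ.g u ≤ C * σ.h t u := by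
  have : ProperSpace Y := FiniteDimensional.proper ℝ Y
  have hKc : IsCompact σ.K := Metric.isCompact_of_isClosed_isBounded σ.K_closed σ.K_bdd
  have hK₁K : K₁ ⊆ σ.K := hK₁.trans interior_subset
  have hK₁c : IsCompact K₁ := hKc.of_isClosed_subset hK₁closed hK₁K
  obtain ⟨r, hr, hrK⟩ := hK₁c.exists_cthickening_subset_open isOpen_interior hK₁
  have hball : ∀ t ∈ K₁, ∀ v, ‖v - t‖ ≤ r → v ∈ σ.K := fun t ht v hv =>
    interior_subset (hrK (Metric.mem_cthickening_of_dist_le v t r K₁ ht (by rwa [dist_eq_norm])))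
  have hPc : IsCompact {p : Y × Y | p ∈ K₁ ×ˢ σ.K ∧ ‖p.2 - p.1‖ = r} :=
    (hK₁c.prod hKc).inter_right
      (isClosed_eq (continuous_snd.sub continuous_fst).norm continuous_const)
  obtain ⟨m, hm0, hm⟩ := hPc.exists_forall_le' (a := 0)
    (σ.continuousOn_h.mono fun p hp => ⟨hK₁K hp.1.1, hp.1.2⟩) (by
      rintro ⟨t, v⟩ ⟨⟨ht, hv⟩, hd⟩
      exact σ.h_pos (hK₁K ht) (σ.K_sub hv)
        (sub_ne_zero.1 (norm_pos_iff.1 (hr.trans_eq hd.symm))).symm)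
  obtain ⟨G, hG⟩ := hKc.exists_bound_of_continuousOn (σ.g_cont.mono σ.K_sub)
  obtain ⟨G', hG'⟩ := hKc.exists_bound_of_continuousOn σ.g'_cont
  refine ⟨1 + (1 + |G|) / m + |G'| * (r / m), by positivity, fun t ht u hu huK => ?_⟩
  have hd : r < ‖u - t‖ := by
    by_contra! hle
    exact huK (hball t ht u hle)
  have hd0 : 0 < ‖u - t‖ := hr.trans hd
  have hs1 : r / ‖u - t‖ ≤ 1 := (div_le_one hd0).2 hd.le
  have hvn : ‖t + (r / ‖u - t‖) • (u - t) - t‖ = r := by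
    rw [add_sub_cancel_left, norm_smul, Real.norm_of_nonneg (by positivity)]
    field_simp
  have hlow : m ≤ r / ‖u - t‖ * σ.h t u :=
    (hm (t, t + (r / ‖u - t‖) • (u - t)) ⟨⟨ht, hball t ht _ hvn.le⟩, hvn⟩).trans
      (σ.h_add_smul_le (σ.K_sub (hK₁K ht)) hu (by positivity) hs1)
  have hh0 : 0 ≤ σ.h t u := σ.h_nonneg (hK₁K ht) hu
  have hmh : m ≤ σ.h t u := hlow.trans (mul_le_of_le_one_left hh0 hs1)
  have hdh : ‖u - t‖ ≤ r / m * σ.h t u := by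
    rw [div_mul_eq_mul_div, le_div_iff₀ hd0] at hlow
    rw [div_mul_eq_mul_div, le_div_iff₀ hm0]
    linarith
  have h1h : 1 ≤ σ.h t u / m := (one_le_div hm0).2 hmh
  have hgt : σ.g t ≤ |G| := (le_abs_self _).trans ((hG t (hK₁K ht)).trans (le_abs_self _))
  have hg't : σ.g' t (u - t) ≤ |G'| * (r / m * σ.h t u) := by
    calc σ.g' t (u - t) ≤ ‖σ.g' t‖ * ‖u - t‖ := (le_abs_self _).trans ((σ.g' t).le_opNorm _)
      _ ≤ |G'| * (r / m * σ.h t u) := by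
        gcongr
        exact (hG' t (hK₁K ht)).trans (le_abs_self _)
  have hgu : σ.g u = σ.h t u + (σ.g t + σ.g' t (u - t)) := by unfold h; ring
  calc 1 + σ.g u ≤ σ.h t u + (1 + |G|) * 1 + |G'| * (r / m * σ.h t u) := by linarith
    _ ≤ σ.h t u + (1 + |G|) * (σ.h t u / m) + |G'| * (r / m * σ.h t u) := by gcongr
    _ = (1 + (1 + |G|) / m + |G'| * (r / m)) * σ.h t u := by ring

end GSettingFin

theorem stmt_16
    [FiniteDimensional ℝ Y]
    {E : Type*} [NormedAddCommGroup E] [NormedSpace ℝ E]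
    (σ : GSettingFin Y)
    -- ψ_t² ∈ C(X;ℝ,g) for every t ∈ Y
    (hpsi : ∀ t : Y, MemCg σ.X σ.g (fun u => ‖u - t‖ ^ 2))
    (DL : ℕ → Submodule ℝ (Y → E)) (DS : ℕ → Submodule ℝ (Y → ℝ))
    (L : ∀ n, DL n →ₗ[ℝ] (Y → E)) (S : ∀ n, DS n →ₗ[ℝ] (Y → ℝ))
    -- each S_n is positive
    (hSpos : ∀ n, ∀ f : DS n, (∀ u ∈ σ.X, 0 ≤ f.1 u) → ∀ t ∈ σ.K, 0 ≤ S n f t)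
    -- each L_n is dominated by S_n
    (hdom_mem : ∀ n, ∀ F : DL n, (fun u => ‖F.1 u‖) ∈ DS n)
    (hdom : ∀ n, ∀ F : DL n, ∀ t ∈ σ.K,
      ‖L n F t‖ ≤ S n ⟨fun u => ‖F.1 u‖, hdom_mem n F⟩ t)
    -- C(X;E,g) ⊆ D(L_n) and C(X;ℝ,g) ⊆ D(S_n)
    (hDL : ∀ n, ∀ F : Y → E, MemCg σ.X σ.g F → F ∈ DL n)
    (hDS : ∀ n, ∀ f : Y → ℝ, MemCg σ.X σ.g f → f ∈ DS n)
    -- K₁ a closed subset of the interior of K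
    (K₁ : Set Y) (hK₁closed : IsClosed K₁) (hK₁ : K₁ ⊆ interior σ.K)
    -- each L_n preserves the constants
    (hconst_mem : ∀ n, ∀ c : E, (fun _ : Y => c) ∈ DL n)
    (hconst : ∀ n, ∀ c : E, ∀ t ∈ σ.K, L n ⟨fun _ => c, hconst_mem n c⟩ t = c)
    -- S_n(𝟙)(t) = 1 on K₁
    (hone_mem : ∀ n, (fun _ : Y => (1 : ℝ)) ∈ DS n)
    (hone : ∀ n, ∀ t ∈ K₁, S n ⟨fun _ => 1, hone_mem n⟩ t = 1) :
    ∀ F : Y → E, ∀ hF : MemCg σ.X σ.g F,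
      ∃ M > (0 : ℝ), ∀ n : ℕ, ∀ t ∈ K₁,
      ∀ (hψ : (fun u => ‖u - t‖ ^ 2) ∈ DS n) (hh : σ.h t ∈ DS n),
      0 < Real.sqrt (S n ⟨fun u => ‖u - t‖ ^ 2, hψ⟩ t) →
      ‖L n ⟨F, hDL n F hF⟩ t - F t‖ ≤
        2 * modulusOfContinuity σ.K F (Real.sqrt (S n ⟨fun u => ‖u - t‖ ^ 2, hψ⟩ t)) +
          M * S n ⟨σ.h t, hh⟩ t := by
  intro F hF
  have : ProperSpace Y := FiniteDimensional.proper ℝ Y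
  have hKc : IsCompact σ.K := Metric.isCompact_of_isClosed_isBounded σ.K_closed σ.K_bdd
  have hK₁K : K₁ ⊆ σ.K := hK₁.trans interior_subset
  have hFK : ContinuousOn F σ.K := hF.1.mono σ.K_sub
  obtain ⟨A, hA0, hA⟩ := hF.2
  obtain ⟨B, hB⟩ := hKc.exists_bound_of_continuousOn hFK
  obtain ⟨C, hC0, hC⟩ := σ.exists_one_add_g_le_mul_h hK₁closed hK₁
  refine ⟨(A + |B|) * C, by positivity, fun n t ht hψ hh hγ => ?_⟩
  have htK : t ∈ σ.K := hK₁K ht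
  set δ := Real.sqrt (S n ⟨fun u => ‖u - t‖ ^ 2, hψ⟩ t) with hδ
  have hδsq : S n ⟨fun u => ‖u - t‖ ^ 2, hψ⟩ t = δ ^ 2 :=
    (Real.sq_sqrt (Real.sqrt_pos.1 hγ).le).symm
  set ω := modulusOfContinuity σ.K F δ with hω
  have hω0 : 0 ≤ ω := modulusOfContinuity_nonneg σ.K F δ
  have hpoint : ∀ u ∈ σ.X,
      ‖F u - F t‖ ≤ ω + ω / δ ^ 2 * ‖u - t‖ ^ 2 + (A + |B|) * C * σ.h t u := by
    intro u hu
    have hh0 : 0 ≤ σ.h t u := σ.h_nonneg htK hu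
    by_cases huK : u ∈ σ.K
    · calc ‖F u - F t‖ ≤ (1 + ‖u - t‖ ^ 2 / δ ^ 2) * ω :=
            norm_sub_le_one_add_sq_mul_modulusOfContinuity hKc σ.K_conv hFK hγ htK huK
        _ = ω + ω / δ ^ 2 * ‖u - t‖ ^ 2 := by ring
        _ ≤ _ := le_add_of_nonneg_right (by positivity)
    · have hg0 := σ.g_pos u hu
      calc ‖F u - F t‖ ≤ ‖F u‖ + ‖F t‖ := norm_sub_le _ _
        _ ≤ A * σ.g u + |B| := add_le_add (hA u hu) ((hB t htK).trans (le_abs_self B))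
        _ ≤ (A + |B|) * (1 + σ.g u) := by nlinarith [mul_nonneg (abs_nonneg B) hg0.le]
        _ ≤ (A + |B|) * (C * σ.h t u) := by gcongr; exact hC t ht u hu huK
        _ = (A + |B|) * C * σ.h t u := by ring
        _ ≤ _ := le_add_of_nonneg_left (by positivity)
  set D : DL n := ⟨F, hDL n F hF⟩ - ⟨fun _ => F t, hconst_mem n (F t)⟩ with hD
  have hLD : L n D t = L n ⟨F, hDL n F hF⟩ t - F t := by
    rw [hD, map_sub, Pi.sub_apply, hconst n (F t) t htK]
  have hS := hSpos n (ω • ⟨fun _ => 1, hone_mem n⟩ + (ω / δ ^ 2) • ⟨fun u => ‖u - t‖ ^ 2, hψ⟩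
    + ((A + |B|) * C) • ⟨σ.h t, hh⟩ - ⟨fun u => ‖D.1 u‖, hdom_mem n D⟩) (fun u hu => by
      simpa [hD] using hpoint u hu) t htK
  simp only [map_sub, map_add, map_smul, Pi.sub_apply, Pi.add_apply, Pi.smul_apply, smul_eq_mul,
    hone n t ht, hδsq] at hS
  have hcancel : ω / δ ^ 2 * δ ^ 2 = ω := div_mul_cancel₀ _ (by positivity)
  have hdomD := hdom n D t htK
  rw [hLD] at hdomD
  linarith
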